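/- Let Λ be a commutative Noetherian domain and let x be a nonzero element of Λ such that Ω := Λ/xΛ is also a domain. Let M be a finitely generated Λ-module. Then rank_Ω(M/xM) = rank_Ω(M[x]) + rank_Λ(M), where M[x] = {m ∈ M : xm = 0}. -/

import Mathlib

open TensorProduct

/-- Additivity of rank over a domain along an exact sequence `0 → A → B → C → D → 0`. -/
theorem Function.Exact.finrank_add_finrank_eq {R A B C D : Type*} [CommRing R] [IsDomain R]
    [AddCommGroup A] [AddCommGroup B] [AddCommGroup C] [AddCommGroup D]
    [Module R A] [Module R B] [Module R C] [Module R D]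
    [Module.Finite R B] [Module.Finite R C]
    {f : A →ₗ[R] B} {g : B →ₗ[R] C} {h : C →ₗ[R] D}
    (hf : Function.Injective f) (hfg : Function.Exact f g) (hgh : Function.Exact g h)
    (hh : Function.Surjective h) :
    Module.finrank R A + Module.finrank R C = Module.finrank R B + Module.finrank R D := by
  have hA := (LinearEquiv.ofInjective f hf).finrank_eq
  have hD := (h.quotKerEquivOfSurjective hh).finrank_eq
  have hg := g.quotKerEquivRange.finrank_eq
  have hB := g.ker.finrank_quotient_add_finrank
  have hC := h.ker.finrank_quotient_add_finrank
  rw [hfg.linearMap_ker_eq] at hB hg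
  rw [hgh.linearMap_ker_eq] at hC hD
  lia

section

variable {R N : Type*} [CommRing R] [AddCommGroup N] [Module R N] {x : R}

theorem Submodule.Quotient.sum_mk_smul_mk {I : Ideal R} {ι : Type*} [Fintype ι] (g : ι → R)
    (y : ι → N) :
    (Submodule.Quotient.mk (∑ i, g i • y i) : N ⧸ (I • ⊤ : Submodule R N)) =
      ∑ i, Ideal.Quotient.mk I (g i) • Submodule.Quotient.mk (y i) :=
  map_sum (I • ⊤ : Submodule R N).mkQ _ _

/-- If `x` is regular on `N`, lifts of a linearly independent family of `N / xN` over `R / x` are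
linearly independent over `R`. -/
theorem IsSMulRegular.linearIndependent_of_quotient [IsDomain R] [IsNoetherianRing R]
    (hx : IsSMulRegular N x) (hI : Ideal.span {x} ≠ ⊤) {ι : Type*} [Fintype ι] {y : ι → N}
    (hy : LinearIndependent (R ⧸ Ideal.span {x})
      fun i ↦ (Submodule.Quotient.mk (y i) : N ⧸ (Ideal.span {x} • ⊤ : Submodule R N))) :
    LinearIndependent R y := by
  rw [Fintype.linearIndependent_iff] at hy ⊢
  have key (k : ℕ) : ∀ g : ι → R, ∑ i, g i • y i = 0 → ∀ i, g i ∈ Ideal.span {x} ^ k := by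
    induction k with
    | zero => simp
    | succ k ih =>
      intro g hg
      have hdvd : ∀ i, x ∣ g i := fun i ↦ by
        rw [← Ideal.mem_span_singleton, ← Ideal.Quotient.eq_zero_iff_mem]
        refine hy (fun i ↦ Ideal.Quotient.mk _ (g i)) ?_ i
        rw [← Submodule.Quotient.sum_mk_smul_mk, hg, Submodule.Quotient.mk_zero]
      choose c hc using hdvd
      have hc' : ∑ i, c i • y i = 0 := hx <| by
        simpa only [Finset.smul_sum, smul_smul, ← hc, smul_zero] using hg
      intro i
      rw [hc i, pow_succ']
      exact Ideal.mul_mem_mul (Ideal.mem_span_singleton_self x) (ih c hc' i)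
  intro g hg i
  rw [← Ideal.mem_bot, ← Ideal.iInf_pow_eq_bot_of_isDomain _ hI, Ideal.mem_iInf]
  exact fun k ↦ key k g hg i

/-- If a finite module `N` satisfies `N_P = P N_P`, then some `s ∉ P` annihilates `N`. -/
theorem Module.exists_notMem_mem_annihilator_of_quotient [Module.Finite R N] (P : Ideal R)
    [P.IsPrime] (h : ∀ n : N, ∃ s ∉ P, s • n ∈ (P • ⊤ : Submodule R N)) :
    ∃ s ∉ P, s ∈ Module.annihilator R N := by
  by_contra! H
  have hN : (⟨P, ‹_›⟩ : PrimeSpectrum R) ∈ Module.support R (N ⧸ (P • ⊤ : Submodule R N)) := by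
    rw [Module.support_quotient]
    refine ⟨?_, (PrimeSpectrum.mem_zeroLocus _ _).2 subset_rfl⟩
    rw [Module.mem_support_iff_of_finite]
    exact fun s hs ↦ not_not.1 fun hs' ↦ H s hs' hs
  obtain ⟨m, hm⟩ := Module.mem_support_iff'.1 hN
  obtain ⟨n, rfl⟩ := Submodule.Quotient.mk_surjective _ m
  obtain ⟨s, hs, hsn⟩ := h n
  exact hm s hs (by rwa [← Submodule.Quotient.mk_smul, Submodule.Quotient.mk_eq_zero])

/-- If `x` is regular on `N`, then `N / xN` has the same rank over `R / x` as `N` over `R`. -/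
theorem IsSMulRegular.finrank_quotient_eq [IsDomain R] [IsNoetherianRing R]
    [IsDomain (R ⧸ Ideal.span {x})] [Module.Finite R N] (hx : IsSMulRegular N x) :
    Module.finrank (R ⧸ Ideal.span {x}) (N ⧸ (Ideal.span {x} • ⊤ : Submodule R N)) =
      Module.finrank R N := by
  have hP : (Ideal.span {x}).IsPrime := (Ideal.Quotient.isDomain_iff_prime _).1 ‹_›
  obtain ⟨b, hb⟩ := exists_linearIndependent_of_le_finrank
    (le_refl (Module.finrank (R ⧸ Ideal.span {x}) (N ⧸ (Ideal.span {x} • ⊤ : Submodule R N))))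
  choose y hy using fun i ↦ Submodule.Quotient.mk_surjective _ (b i)
  obtain rfl : (fun i ↦ Submodule.Quotient.mk (y i)) = b := funext hy
  have hyi := hx.linearIndependent_of_quotient hP.ne_top hb
  set Y := Submodule.span R (Set.range y)
  set W := Submodule.span (R ⧸ Ideal.span {x}) (Set.range fun i ↦
    (Submodule.Quotient.mk (y i) : N ⧸ (Ideal.span {x} • ⊤ : Submodule R N)))
  have hYr : Module.finrank R Y = _ := (finrank_span_eq_card hyi).trans (Fintype.card_fin _)
  have hWr : Module.finrank _ W = _ := (finrank_span_eq_card hb).trans (Fintype.card_fin _)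
  have hYq := Y.finrank_quotient_add_finrank
  have hWq := W.finrank_quotient_add_finrank
  have hWt : Module.IsTorsion (R ⧸ Ideal.span {x}) (_ ⧸ W) :=
    Module.finrank_eq_zero_iff_isTorsion.1 (by omega)
  obtain ⟨s, hs, hsY⟩ := Module.exists_notMem_mem_annihilator_of_quotient
    (N := N ⧸ Y) (Ideal.span {x}) fun q ↦ by
      obtain ⟨n, rfl⟩ := Submodule.Quotient.mk_surjective _ q
      obtain ⟨⟨ω, hω⟩, hωn⟩ := @hWt (Submodule.Quotient.mk (Submodule.Quotient.mk n))
      obtain ⟨s, rfl⟩ := Ideal.Quotient.mk_surjective ω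
      refine ⟨s, fun h ↦ nonZeroDivisors.ne_zero hω (Ideal.Quotient.eq_zero_iff_mem.2 h), ?_⟩
      rw [Submonoid.mk_smul, ← Submodule.Quotient.mk_smul, Submodule.Quotient.mk_eq_zero,
        Submodule.mem_span_range_iff_exists_fun] at hωn
      obtain ⟨c, hc⟩ := hωn
      choose d hd using fun i ↦ Ideal.Quotient.mk_surjective (c i)
      simp only [← hd] at hc
      rw [← Submodule.Quotient.sum_mk_smul_mk, Module.Quotient.mk_smul_mk] at hc
      have hc' := (Submodule.Quotient.eq _).1 hc.symm
      have hdY : ∑ i, d i • y i ∈ Y :=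
        sum_mem fun i _ ↦ Y.smul_mem _ (Submodule.subset_span ⟨i, rfl⟩)
      have := Submodule.mem_map_of_mem (f := Y.mkQ) hc'
      rw [map_sub, Submodule.mkQ_apply, Submodule.mkQ_apply,
        (Submodule.Quotient.mk_eq_zero Y).2 hdY, sub_zero, Submodule.map_smul''] at this
      exact Submodule.smul_mono le_rfl le_top this
  have hYt : Module.finrank R (N ⧸ Y) = 0 := Module.finrank_eq_zero_iff_isTorsion.2 fun {q} ↦
    ⟨⟨s, mem_nonZeroDivisors_of_ne_zero fun h ↦ hs (h ▸ zero_mem _)⟩,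
      Module.mem_annihilator.1 hsY q⟩
  omega

end

theorem LinearMap.exact_lsmul_mkQ {R : Type*} [CommRing R] (x : R) (N : Type*) [AddCommGroup N]
    [Module R N] : Function.Exact (LinearMap.lsmul R N x)
      (Ideal.span {x} • ⊤ : Submodule R N).mkQ := by
  rw [LinearMap.exact_iff, Submodule.ker_mkQ, Submodule.ideal_span_singleton_smul]
  ext
  simp [Submodule.mem_smul_pointwise_iff_exists]

/-- The map `A / IA → B / IB` induced by a linear map `A → B`. -/
def Submodule.quotientSMulTopMap {R A B : Type*} [CommRing R] [AddCommGroup A] [AddCommGroup B]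
    [Module R A] [Module R B] (I : Ideal R) (f : A →ₗ[R] B) :
    (A ⧸ (I • ⊤ : Submodule R A)) →ₗ[R] B ⧸ (I • ⊤ : Submodule R B) :=
  Submodule.mapQ _ _ f <| by
    rw [← Submodule.map_le_iff_le_comap, Submodule.map_smul'']
    exact Submodule.smul_mono le_rfl le_top

theorem Submodule.exact_quotientSMulTopMap {R A B C : Type*} [CommRing R] [AddCommGroup A]
    [AddCommGroup B] [AddCommGroup C] [Module R A] [Module R B] [Module R C] (x : R)
    {f : A →ₗ[R] B} {g : B →ₗ[R] C} (hfg : Function.Exact f g) (hg : Function.Surjective g) :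
    Function.Exact (Submodule.quotientSMulTopMap (Ideal.span {x}) f)
      (Submodule.quotientSMulTopMap (Ideal.span {x}) g) := by
  intro q
  constructor
  · obtain ⟨b, rfl⟩ := Submodule.Quotient.mk_surjective _ q
    intro h
    obtain ⟨c, hc⟩ := (LinearMap.exact_lsmul_mkQ x C (g b)).1 h
    obtain ⟨b', rfl⟩ := hg c
    obtain ⟨a, ha⟩ := (hfg (b - x • b')).1 (by
      rw [map_sub, map_smul, sub_eq_zero]
      exact hc.symm)
    refine ⟨Submodule.Quotient.mk a, ?_⟩
    change Submodule.Quotient.mk (f a) = _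
    rw [ha, Submodule.Quotient.mk_sub, sub_eq_self]
    exact (LinearMap.exact_lsmul_mkQ x B).apply_apply_eq_zero b'
  · rintro ⟨a, rfl⟩
    obtain ⟨a, rfl⟩ := Submodule.Quotient.mk_surjective _ a
    change Submodule.Quotient.mk (g (f a)) = _
    rw [hfg.apply_apply_eq_zero, Submodule.Quotient.mk_zero]

theorem Module.finrank_quotient_eq_finrank_torsionBy_add_finrank {R M : Type*} [CommRing R]
    [IsDomain R] [IsNoetherianRing R] {x : R} (hx : x ≠ 0) [IsDomain (R ⧸ Ideal.span {x})]
    [AddCommGroup M] [Module R M] [Module.Finite R M] :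
    Module.finrank (R ⧸ Ideal.span {x}) (M ⧸ (Ideal.span {x} • ⊤ : Submodule R M)) =
      Module.finrank (R ⧸ Ideal.span {x}) (Submodule.torsionBy R M x) + Module.finrank R M := by
  obtain ⟨n, p, hp⟩ := Module.Finite.exists_fin' R M
  have hF : IsSMulRegular (Fin n → R) x := IsSMulRegular.of_ne_zero hx
  let δ := SnakeLemma.δ' (LinearMap.lsmul R p.ker x) (LinearMap.lsmul R (Fin n → R) x)
    (LinearMap.lsmul R M x) p.ker.subtype p p.exact_subtype_ker_map p.ker.subtype p
    p.exact_subtype_ker_map (by ext; simp) (by ext; simp)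
    (Submodule.torsionBy R M x).subtype (by
      rw [LinearMap.exact_iff, Submodule.range_subtype]; rfl)
    (Ideal.span {x} • ⊤ : Submodule R p.ker).mkQ
    (LinearMap.exact_lsmul_mkQ x _) hp Subtype.val_injective
  let g := Submodule.quotientSMulTopMap (Ideal.span {x}) p.ker.subtype
  let h := Submodule.quotientSMulTopMap (Ideal.span {x}) p
  have hgh : Function.Exact g h := Submodule.exact_quotientSMulTopMap x p.exact_subtype_ker_map hp
  have hδg : Function.Exact δ g := SnakeLemma.exact_δ'_left _ _ _ _ _ _ _ _ _ _ _ _ _ _ _ _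
    (LinearMap.exact_lsmul_mkQ x _) hp Subtype.val_injective _ rfl (Submodule.mkQ_surjective _)
  have hδ : Function.Injective δ := by
    rw [injective_iff_map_eq_zero]
    intro m hm
    obtain ⟨z, rfl⟩ := (SnakeLemma.exact_δ'_right _ _ _ _ _ _ _ _ _ _ _
      (0 : PUnit.{1} →ₗ[R] Fin n → R) (by
        rw [LinearMap.exact_iff, LinearMap.range_zero]
        exact LinearMap.ker_eq_bot.2 hF) _ _ _ _ hp Subtype.val_injective
      (0 : PUnit.{1} →ₗ[R] Submodule.torsionBy R M x) (by simp) Subtype.val_injective m).1 hm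
    rfl
  have hh : Function.Surjective h := fun q ↦ by
    obtain ⟨m, rfl⟩ := Submodule.Quotient.mk_surjective _ q
    obtain ⟨v, rfl⟩ := hp m
    exact ⟨Submodule.Quotient.mk v, rfl⟩
  have hs : Function.Surjective (algebraMap R (R ⧸ Ideal.span {x})) := Ideal.Quotient.mk_surjective
  have key := Function.Exact.finrank_add_finrank_eq (R := R ⧸ Ideal.span {x})
    (f := δ.extendScalarsOfSurjective hs) (g := g.extendScalarsOfSurjective hs)
    (h := h.extendScalarsOfSurjective hs) hδ hδg hgh hh
  have e₁ := hF.finrank_quotient_eq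
  have e₂ := IsSMulRegular.finrank_quotient_eq (N := p.ker) (IsSMulRegular.of_ne_zero hx)
  have e₃ := p.ker.finrank_quotient_add_finrank
  have e₄ := (p.quotKerEquivOfSurjective hp).finrank_eq
  omega

theorem IsFractionRing.finrank_tensorProduct (R K N : Type*) [CommRing R] [IsDomain R] [Field K]
    [Algebra R K] [IsFractionRing R K] [AddCommGroup N] [Module R N] :
    Module.finrank K (K ⊗[R] N) = Module.finrank R N :=
  (IsFractionRing.finrank_right_eq R K _).trans <|
    IsLocalizedModule.finrank_eq (nonZeroDivisors R) (TensorProduct.mk R K N 1) le_rfl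

/-!
STATEMENT 6: Let Λ be a commutative Noetherian domain and `x ≠ 0` such that
`Ω := Λ/xΛ` is also a domain.  Let `M` be a finitely generated Λ-module.  Then
`rank_Ω(M/xM) = rank_Ω(M[x]) + rank_Λ(M)`, where for a f.g. module `N` over a domain
`R` with fraction field `K(R)`, `rank_R N := dim_{K(R)} (K(R) ⊗_R N)`.
-/
theorem rank_quotient_eq_rank_torsion_add_rank
    {Λ : Type*} [CommRing Λ] [IsDomain Λ] [IsNoetherianRing Λ]
    (x : Λ) (hx : x ≠ 0)
    [IsDomain (Λ ⧸ Ideal.span {x})]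
    {M : Type*} [AddCommGroup M] [Module Λ M] [Module.Finite Λ M] :
    Module.finrank (FractionRing (Λ ⧸ Ideal.span {x}))
        (FractionRing (Λ ⧸ Ideal.span {x}) ⊗[Λ ⧸ Ideal.span {x}]
          (M ⧸ (Ideal.span {x} • ⊤ : Submodule Λ M)))
      = Module.finrank (FractionRing (Λ ⧸ Ideal.span {x}))
          (FractionRing (Λ ⧸ Ideal.span {x}) ⊗[Λ ⧸ Ideal.span {x}]
            (Submodule.torsionBy Λ M x))
        + Module.finrank (FractionRing Λ) (FractionRing Λ ⊗[Λ] M) := by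
  simp only [IsFractionRing.finrank_tensorProduct]
  exact Module.finrank_quotient_eq_finrank_torsionBy_add_finrank hx
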